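/- Let n ≥ 1, let D be a symmetric real n×n matrix with zero diagonal, and suppose U is an orthogonal n×n matrix and λ : Fin n → ℝ satisfy −(1/2)·C·D·C = U·diag(λ)·Uᵀ. Let λ̃ : Fin n → ℝ, set Δλ := λ − λ̃ and B̃ := U·diag(λ̃)·Uᵀ, and define D̃ by D̃_{ij} := B̃_{ii} + B̃_{jj} − 2·B̃_{ij}. Assume B̃·𝟙 = 0, where 𝟙 is the all-ones vector. Then ‖D̃ − D‖_F² ≥ 4·Σ_i (Δλ_i)² + 4·(Σ_i Δλ_i)²; that is, the term C̃₃ in the STRESS decomposition is nonnegative. -/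

import Mathlib

open Matrix BigOperators

/-- The all-ones matrix. -/
def Jmat (n : ℕ) : Matrix (Fin n) (Fin n) ℝ := Matrix.of fun _ _ => (1 : ℝ)

/-- The centering matrix `C = I - (1/n) J`. -/
noncomputable def Cmat (n : ℕ) : Matrix (Fin n) (Fin n) ℝ :=
  (1 : Matrix (Fin n) (Fin n) ℝ) - ((1 : ℝ) / n) • Jmat n

theorem Cmat_mulVec_one {n : ℕ} (hn : 1 ≤ n) : Cmat n *ᵥ (fun _ => (1 : ℝ)) = 0 := by
  have hn' : (n : ℝ) ≠ 0 := by positivity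
  ext i
  simp [Cmat, Jmat, mulVec, dotProduct, one_apply, hn']

theorem Cmat_mul_mul_apply {n : ℕ} (D : Matrix (Fin n) (Fin n) ℝ) (i j : Fin n) :
    (Cmat n * D * Cmat n) i j =
      D i j - (1 / n) * ∑ k, D k j - (1 / n) * ∑ k, D i k
        + (1 / n) * ((1 / n) * ∑ k, ∑ m, D m k) := by
  simp only [Cmat, Matrix.sub_mul, Matrix.mul_sub, Matrix.one_mul, Matrix.mul_one,
    Matrix.smul_mul, Matrix.mul_smul, Matrix.sub_apply, Matrix.smul_apply, smul_eq_mul]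
  simp only [Jmat, Matrix.mul_apply, Matrix.of_apply, one_mul, mul_one]
  ring

/-- A hollow symmetric matrix is recovered from its doubly centered Gram matrix. -/
theorem eq_diag_add_diag_sub_of_centered {n : ℕ} {D B : Matrix (Fin n) (Fin n) ℝ}
    (hsymm : D.IsSymm) (hhollow : ∀ i, D i i = 0)
    (hB : (-(1 / 2) : ℝ) • (Cmat n * D * Cmat n) = B) (i j : Fin n) :
    B i i + B j j - 2 * B i j = D i j := by
  have hcol (j : Fin n) : ∑ k, D k j = ∑ k, D j k :=
    Finset.sum_congr rfl fun k _ => hsymm.apply j k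
  simp only [← hB, Matrix.smul_apply, smul_eq_mul, Cmat_mul_mul_apply, hhollow, hcol]
  ring

theorem sum_sum_diag_add_diag_sub_sq_ge {n : ℕ} {E : Matrix (Fin n) (Fin n) ℝ}
    (hE : E.IsSymm) (hrow : ∀ i, ∑ j, E i j = 0) :
    4 * ∑ i, ∑ j, E i j ^ 2 + 4 * E.trace ^ 2 ≤
      ∑ i, ∑ j, (E i i + E j j - 2 * E i j) ^ 2 := by
  have hcol (j : Fin n) : ∑ i, E i j = 0 := by
    rw [← hrow j]
    exact Finset.sum_congr rfl fun i _ => hE.apply j i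
  have hleft : ∑ i, ∑ j, E i i * E i j = 0 := by
    simp [← Finset.mul_sum, hrow]
  have hright : ∑ i, ∑ j, E j j * E i j = 0 := by
    rw [Finset.sum_comm]
    simp [← Finset.mul_sum, hcol]
  have hcs : E.trace ^ 2 ≤ n * ∑ i, E i i ^ 2 := by
    simpa [Matrix.trace] using
      sq_sum_le_card_mul_sum_sq (s := Finset.univ) (f := fun i => E i i)
  have hcross : ∑ i, ∑ j, E i i * E j j = E.trace ^ 2 := by
    rw [← Finset.sum_mul_sum, sq]
    rfl
  have hexpand : ∑ i, ∑ j, (E i i + E j j - 2 * E i j) ^ 2 =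
      2 * (n * ∑ i, E i i ^ 2) + 2 * (∑ i, ∑ j, E i i * E j j)
        - 4 * (∑ i, ∑ j, E i i * E i j) - 4 * (∑ i, ∑ j, E j j * E i j)
        + 4 * ∑ i, ∑ j, E i j ^ 2 := by
    have hpt (i j : Fin n) : (E i i + E j j - 2 * E i j) ^ 2 =
        E i i ^ 2 + E j j ^ 2 + 2 * (E i i * E j j) - 4 * (E i i * E i j)
          - 4 * (E j j * E i j) + 4 * E i j ^ 2 := by ring
    simp only [hpt, Finset.sum_add_distrib, Finset.sum_sub_distrib, ← Finset.mul_sum,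
      Finset.sum_const, Finset.card_univ, Fintype.card_fin, nsmul_eq_mul]
    ring
  rw [hexpand, hleft, hright, hcross]
  linarith

theorem trace_conj_diagonal {n : ℕ} {U : Matrix (Fin n) (Fin n) ℝ} (hU : U * Uᵀ = 1)
    (d : Fin n → ℝ) : (U * diagonal d * Uᵀ).trace = ∑ i, d i := by
  rw [trace_mul_comm, ← Matrix.mul_assoc, mul_eq_one_comm.mp hU, Matrix.one_mul, trace_diagonal]

theorem isSymm_conj_diagonal {n : ℕ} (U : Matrix (Fin n) (Fin n) ℝ) (d : Fin n → ℝ) :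
    (U * diagonal d * Uᵀ).IsSymm := by
  simp [IsSymm, transpose_mul, Matrix.mul_assoc]

theorem sum_sq_conj_diagonal {n : ℕ} {U : Matrix (Fin n) (Fin n) ℝ} (hU : U * Uᵀ = 1)
    (d : Fin n → ℝ) : ∑ i, ∑ j, (U * diagonal d * Uᵀ) i j ^ 2 = ∑ i, d i ^ 2 := by
  have hsq : (U * diagonal d * Uᵀ) * (U * diagonal d * Uᵀ)ᵀ =
      U * diagonal (fun i => d i ^ 2) * Uᵀ := by
    rw [(isSymm_conj_diagonal U d).eq]
    calc U * diagonal d * Uᵀ * (U * diagonal d * Uᵀ)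
        = U * diagonal d * (Uᵀ * U) * diagonal d * Uᵀ := by simp only [Matrix.mul_assoc]
      _ = U * diagonal (fun i => d i ^ 2) * Uᵀ := by
        rw [mul_eq_one_comm.mp hU, Matrix.mul_one, Matrix.mul_assoc U, diagonal_mul_diagonal]
        simp only [sq]
  rw [← trace_conj_diagonal hU (fun i => d i ^ 2), ← hsq]
  generalize U * diagonal d * Uᵀ = M
  simp only [Matrix.trace, Matrix.diag, Matrix.mul_apply, transpose_apply, sq]

theorem stress_lower_bound_C3_nonneg (n : ℕ) (hn : 1 ≤ n)
    (D : Matrix (Fin n) (Fin n) ℝ)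
    (hsymm : D.IsSymm) (hhollow : ∀ i, D i i = 0)
    (U : Matrix (Fin n) (Fin n) ℝ) (hU : U * Uᵀ = 1) (l : Fin n → ℝ)
    (hdecomp : (-(1 / 2) : ℝ) • (Cmat n * D * Cmat n) = U * Matrix.diagonal l * Uᵀ)
    (lt : Fin n → ℝ)
    (hcenter : (U * Matrix.diagonal lt * Uᵀ) *ᵥ (fun _ => (1 : ℝ)) = 0) :
    let dl : Fin n → ℝ := fun i => l i - lt i
    let Bt : Matrix (Fin n) (Fin n) ℝ := U * Matrix.diagonal lt * Uᵀ
    let Dt : Matrix (Fin n) (Fin n) ℝ :=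
      Matrix.of fun i j => Bt i i + Bt j j - 2 * Bt i j
    ∑ i, ∑ j, (Dt i j - D i j) ^ 2
      ≥ 4 * ∑ i, (dl i) ^ 2 + 4 * (∑ i, dl i) ^ 2 := by
  intro dl Bt Dt
  set B := U * diagonal l * Uᵀ
  set E := U * diagonal dl * Uᵀ
  have hEsub : E = B - Bt := by
    simp only [E, B, Bt, dl, ← Matrix.sub_mul, ← Matrix.mul_sub, diagonal_sub]
  have hB1 : B *ᵥ (fun _ => (1 : ℝ)) = 0 := by
    rw [← hdecomp, smul_mulVec, ← mulVec_mulVec, Cmat_mulVec_one hn, mulVec_zero, smul_zero]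
  have hrow (i : Fin n) : ∑ j, E i j = 0 := by
    have hE1 : E *ᵥ (fun _ => (1 : ℝ)) = 0 := by
      rw [hEsub, sub_mulVec, hB1, hcenter, sub_zero]
    simpa [mulVec, dotProduct] using congrFun hE1 i
  have hdiff (i j : Fin n) : (Dt i j - D i j) ^ 2 = (E i i + E j j - 2 * E i j) ^ 2 := by
    rw [← eq_diag_add_diag_sub_of_centered hsymm hhollow hdecomp i j, hEsub]
    simp only [Dt, Matrix.of_apply, Matrix.sub_apply]
    ring
  have hmain := sum_sum_diag_add_diag_sub_sq_ge (isSymm_conj_diagonal U dl) hrow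
  rw [sum_sq_conj_diagonal hU, trace_conj_diagonal hU] at hmain
  simpa only [hdiff] using hmain
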